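/- Let k ≥ 1 be an integer, let x ≥ 1 be a real number, and let n₁,…,n_k be positive integers with n_i ≤ x for all i. Then (x−1)^k ≥ ∏_{i=1}^{k} (x−n_i) ≥ (x−1)^{k−1} (x − n₁⋯n_k). -/

import Mathlib

open Finset

/-- The two-variable inequality `(x - u) (x - v) ≥ (x - 1) (x - u v)`. -/
theorem sub_one_mul_sub_mul_le {x u v : ℝ} (hx : 0 ≤ x) (hu : 1 ≤ u) (hv : 1 ≤ v) :
    (x - 1) * (x - u * v) ≤ (x - u) * (x - v) := by
  have h := mul_nonneg hx (mul_nonneg (sub_nonneg.2 hu) (sub_nonneg.2 hv))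
  linarith

theorem sub_one_pow_mul_sub_prod_le_prod_sub {x : ℝ} (hx : 1 ≤ x) (k : ℕ)
    (a : Fin (k + 1) → ℝ) (ha : ∀ i, 1 ≤ a i) (hax : ∀ i, a i ≤ x) :
    (x - 1) ^ k * (x - ∏ i, a i) ≤ ∏ i, (x - a i) := by
  induction k with
  | zero => simp
  | succ k ih =>
    rw [Fin.prod_univ_succ, Fin.prod_univ_succ (fun i => x - a i)]
    have hprod : 1 ≤ ∏ i : Fin (k + 1), a i.succ :=
      Finset.one_le_prod fun i _ => ha i.succ
    calc
      (x - 1) ^ (k + 1) * (x - a 0 * ∏ i : Fin (k + 1), a i.succ)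
          = (x - 1) ^ k * ((x - 1) * (x - a 0 * ∏ i : Fin (k + 1), a i.succ)) := by ring
      _ ≤ (x - 1) ^ k * ((x - a 0) * (x - ∏ i : Fin (k + 1), a i.succ)) :=
        mul_le_mul_of_nonneg_left
          (sub_one_mul_sub_mul_le (zero_le_one.trans hx) (ha 0) hprod)
          (pow_nonneg (sub_nonneg.2 hx) k)
      _ = (x - a 0) * ((x - 1) ^ k * (x - ∏ i : Fin (k + 1), a i.succ)) := by ring
      _ ≤ (x - a 0) * ∏ i : Fin (k + 1), (x - a i.succ) :=
        mul_le_mul_of_nonneg_left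
          (ih (fun i => a i.succ) (fun i => ha i.succ) fun i => hax i.succ)
          (sub_nonneg.2 (hax 0))

/-- for `x ≥ 1` and positive integers `n₁, …, n_k ≤ x`,
`(x−1)^k ≥ ∏ (x−nᵢ) ≥ (x−1)^{k−1} (x − n₁⋯n_k)`. -/
theorem statement8 (k : ℕ) (hk : 1 ≤ k) (x : ℝ) (hx : 1 ≤ x) (n : Fin k → ℕ)
    (hn : ∀ i, 1 ≤ n i) (hnx : ∀ i, (n i : ℝ) ≤ x) :
    (∏ i, (x - (n i : ℝ))) ≤ (x - 1) ^ k ∧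
    (x - 1) ^ (k - 1) * (x - ((∏ i, n i : ℕ) : ℝ)) ≤ ∏ i, (x - (n i : ℝ)) := by
  have hn' : ∀ i, (1 : ℝ) ≤ n i := fun i => by exact_mod_cast hn i
  constructor
  · calc
      ∏ i, (x - (n i : ℝ)) ≤ ∏ _i : Fin k, (x - 1) :=
        Finset.prod_le_prod (fun i _ => sub_nonneg.2 (hnx i))
          fun i _ => sub_le_sub_left (hn' i) x
      _ = (x - 1) ^ k := by simp
  · obtain ⟨k, rfl⟩ := Nat.exists_eq_add_of_le' hk
    rw [Nat.cast_prod, Nat.add_sub_cancel]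
    exact sub_one_pow_mul_sub_prod_le_prod_sub hx k _ hn' hnx
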